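/- arXiv:1404.6022 — 2 statements merged into one kernel-verified Lean document; each statement's English description precedes it below -/
import Mathlib

section
/- For every positive integer k there is a constant C_k > 0 such that for all integers N ≥ 1, all reals P ≥ 1, and every function f : [N] → ℂ, one has Σ_{p ≤ P, p prime} I_p(f)^{k/(2k−1)} ≤ C_k · P^{(k−1)/(2k−1)} · (N^{1/(2k−1)} + P^{2k/(2k−1)}) · Σ_{n=1}^{N} |f(n)|^{2k/(2k−1)}, where I_p(f) = Σ_{a=1}^{p−1} |f̂(a/p)|². -/
open scoped Real

/-- The primes `p ≤ P` (for a real bound `P ≥ 0`). -/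
noncomputable def primesUpTo (P : ℝ) : Finset ℕ :=
  (Finset.range (⌊P⌋₊ + 1)).filter Nat.Prime

/-- The Fourier transform `f̂(x) = ∑_{n=1}^N f(n) e(-xn)` of `f : [N] → ℂ`. -/
noncomputable def fourierT (N : ℕ) (f : ℕ → ℂ) (x : ℝ) : ℂ :=
  ∑ n ∈ Finset.Icc 1 N, f n * Complex.exp (-(2 * π * Complex.I * x * n))

/-- `I_p(f) = ∑_{a=1}^{p-1} |f̂(a/p)|²`. -/
noncomputable def Ip (N : ℕ) (f : ℕ → ℂ) (p : ℕ) : ℝ :=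
  ∑ a ∈ Finset.Icc 1 (p - 1), ‖fourierT N f ((a : ℝ) / p)‖ ^ 2

/-- Two functions on `ℤ/L` with coprime periods are uncorrelated. -/
theorem card_mul_sum_mul_of_coprime_periods {𝕜 : Type*} [Field 𝕜] [CharZero 𝕜] {L : ℕ} [NeZero L]
    {q p : ℕ} (h : q.Coprime p) {a b : ZMod L → 𝕜} (ha : Function.Periodic a (q : ZMod L))
    (hb : Function.Periodic b (p : ZMod L)) :
    (L : 𝕜) * ∑ x, a x * b x = (∑ x, a x) * ∑ x, b x := by
  have hshift : ∀ (g : ZMod L → 𝕜) (c : ZMod L), ∑ x, g (x + c) = ∑ x, g x := fun g c =>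
    Equiv.sum_comp (Equiv.addRight c) g
  set φ : ZMod L → 𝕜 := fun x => ∑ t : ZMod L, b (x + q * t) with hφ
  have hφq : Function.Periodic φ (q : ZMod L) := by
    intro x
    rw [hφ]
    change ∑ t : ZMod L, b (x + q + q * t) = ∑ t : ZMod L, b (x + q * t)
    rw [← hshift (fun t => b (x + q * t)) 1]
    refine Finset.sum_congr rfl fun t _ => ?_
    congr 1
    ring
  have hφp : Function.Periodic φ (p : ZMod L) := by
    intro x
    refine Finset.sum_congr rfl fun t _ => ?_
    rw [add_right_comm]
    exact hb _
  have hφ1 : Function.Periodic φ (1 : ZMod L) := by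
    have h1 := (hφq.int_mul (q.gcdA p)).add_period (hφp.int_mul (q.gcdB p))
    have h2 : ((q.gcdA p : ℤ) : ZMod L) * q + ((q.gcdB p : ℤ) : ZMod L) * p = 1 := by
      have := congrArg (Int.cast : ℤ → ZMod L) (Nat.gcd_eq_gcd_ab q p)
      rw [h.gcd_eq_one] at this
      push_cast at this
      rw [this]
      ring
    rwa [h2] at h1
  have hconst : ∀ x, φ x = φ 0 := by
    intro x
    have := (hφ1.nat_mul x.val) 0
    simpa using this
  have hL : (L : 𝕜) ≠ 0 := Nat.cast_ne_zero.mpr (NeZero.ne L)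
  have hφb : ∀ x, φ x = ∑ y, b y := by
    intro x
    have h1 : ∑ x, φ x = L * ∑ y, b y := by
      rw [hφ, Finset.sum_comm]
      simp [hshift b, ZMod.card]
    have h2 : ∑ x, φ x = L * φ x := by
      simp [hconst, ZMod.card]
    exact mul_left_cancel₀ hL (h2.symm.trans h1)
  have hat : ∀ t : ZMod L, ∑ x, a x * b x = ∑ x, a x * b (x + q * t) := by
    intro t
    rw [← hshift (fun x => a x * b x) (q * t)]
    refine Finset.sum_congr rfl fun x _ => ?_
    have := (ha.nat_mul t.val) x
    simp only [ZMod.natCast_val, ZMod.cast_id', id_eq] at this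
    rw [mul_comm (t : ZMod L)] at this
    rw [this]
  calc (L : 𝕜) * ∑ x, a x * b x = ∑ _t : ZMod L, ∑ x, a x * b x := by simp [ZMod.card]
    _ = ∑ t : ZMod L, ∑ x, a x * b (x + q * t) := Finset.sum_congr rfl fun t _ => hat t
    _ = ∑ x, a x * φ x := by
      rw [Finset.sum_comm]
      simp [hφ, Finset.mul_sum]
    _ = (∑ x, a x) * ∑ x, b x := by
      simp [hφb, Finset.sum_mul]

/-- A second order Taylor bound for `|s + x| ^ (2 (j + 1))`, in terms of `A = |s|²`, `B = |x|²` and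
`ℓ = 2 Re (s̄ x)`. -/
theorem exists_abs_add_add_pow_sub_le (j : ℕ) : ∃ C : ℝ, 0 ≤ C ∧ ∀ A B l : ℝ, 0 ≤ A → 0 ≤ B →
    l ^ 2 ≤ 4 * (A * B) →
    |(A + l + B) ^ (j + 1) - A ^ (j + 1) - (j + 1) * A ^ j * l| ≤
      C * (A ^ j * B + B ^ (j + 1)) := by
  induction j with
  | zero =>
    refine ⟨1, zero_le_one, fun A B l _ hB _ => ?_⟩
    have : (A + l + B) ^ (0 + 1) - A ^ (0 + 1) - ((0 : ℕ) + 1) * A ^ 0 * l = B := by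
      push_cast; ring
    rw [this, abs_of_nonneg hB]
    simp [hB]
  | succ j ih =>
    obtain ⟨C, hC, ih⟩ := ih
    refine ⟨8 * (j + 1) + 1 + 8 * C, by positivity, fun A B l hA hB hl => ?_⟩
    have hlAB : |l| ≤ A + B := by
      apply abs_le_of_sq_le_sq _ (by positivity)
      nlinarith [sq_nonneg (A - B)]
    set E := (A + l + B) ^ (j + 1) - A ^ (j + 1) - (j + 1) * A ^ j * l with hE
    have hEb : |E| ≤ C * (A ^ j * B + B ^ (j + 1)) := ih A B l hA hB hl
    have hdec : (A + l + B) ^ (j + 1 + 1) - A ^ (j + 1 + 1) - ((j + 1 : ℕ) + 1) * A ^ (j + 1) * l =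
        (j + 1) * A ^ j * l ^ 2 + B * A ^ (j + 1) + (j + 1) * A ^ j * B * l + (A + l + B) * E := by
      rw [hE]; push_cast; ring
    have hm1 : A ^ j * B ^ 2 ≤ A ^ (j + 1) * B + B ^ (j + 2) := by
      rcases le_total A B with h | h
      · have : A ^ j * B ^ 2 ≤ B ^ j * B ^ 2 := by gcongr
        have h2 : 0 ≤ A ^ (j + 1) * B := by positivity
        rw [pow_add B j 2]; linarith
      · have : A ^ j * B * B ≤ A ^ j * B * A := by gcongr
        have h2 : 0 ≤ B ^ (j + 2) := by positivity
        calc A ^ j * B ^ 2 = A ^ j * B * B := by ring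
          _ ≤ A ^ j * B * A := this
          _ = A ^ (j + 1) * B := by ring
          _ ≤ _ := by linarith
    have hm2 : A * B ^ (j + 1) ≤ A ^ (j + 1) * B + B ^ (j + 2) := by
      rcases le_total A B with h | h
      · have : A * B ^ (j + 1) ≤ B * B ^ (j + 1) := by gcongr
        have h2 : 0 ≤ A ^ (j + 1) * B := by positivity
        have h3 : B * B ^ (j + 1) = B ^ (j + 2) := by ring
        linarith
      · have : A * B * B ^ j ≤ A * B * A ^ j := by gcongr
        have h2 : 0 ≤ B ^ (j + 2) := by positivity
        calc A * B ^ (j + 1) = A * B * B ^ j := by ring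
          _ ≤ A * B * A ^ j := this
          _ = A ^ (j + 1) * B := by ring
          _ ≤ _ := by linarith
    set Z := A ^ (j + 1) * B + B ^ (j + 2) with hZ
    have hZ1 : A ^ (j + 1) * B ≤ Z := by
      have : 0 ≤ B ^ (j + 2) := by positivity
      linarith
    have hZ2 : B ^ (j + 2) ≤ Z := by
      have : 0 ≤ A ^ (j + 1) * B := by positivity
      linarith
    have e1 : |(j + 1) * A ^ j * l ^ 2| ≤ 4 * (j + 1) * Z := by
      rw [abs_of_nonneg (by positivity)]
      calc (j + 1) * A ^ j * l ^ 2 ≤ (j + 1) * A ^ j * (4 * (A * B)) := by gcongr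
        _ = 4 * (j + 1) * (A ^ (j + 1) * B) := by ring
        _ ≤ _ := by gcongr
    have e2 : |B * A ^ (j + 1)| ≤ Z := by
      rw [abs_of_nonneg (by positivity), mul_comm]; exact hZ1
    have e3 : |(j + 1) * A ^ j * B * l| ≤ 2 * (j + 1) * Z := by
      rw [abs_mul, abs_of_nonneg (by positivity : 0 ≤ (j + 1) * A ^ j * B)]
      calc (j + 1) * A ^ j * B * |l| ≤ (j + 1) * A ^ j * B * (A + B) := by gcongr
        _ = (j + 1) * (A ^ (j + 1) * B + A ^ j * B ^ 2) := by ring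
        _ ≤ (j + 1) * (Z + Z) := by gcongr
        _ = _ := by ring
    have e4 : |(A + l + B) * E| ≤ 8 * C * Z := by
      rw [abs_mul]
      have : |A + l + B| ≤ 2 * (A + B) := by
        rw [abs_le] at hlAB ⊢
        constructor <;> linarith
      calc |A + l + B| * |E| ≤ (2 * (A + B)) * (C * (A ^ j * B + B ^ (j + 1))) := by gcongr
        _ = 2 * C * (A ^ (j + 1) * B + A * B ^ (j + 1) + A ^ j * B ^ 2 + B ^ (j + 2)) := by ring
        _ ≤ 2 * C * (Z + Z + Z + Z) := by gcongr
        _ = _ := by ring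
    have hZ0 : 0 ≤ Z := by positivity
    have hfin : |(j + 1) * A ^ j * l ^ 2 + B * A ^ (j + 1) + (j + 1) * A ^ j * B * l +
        (A + l + B) * E| ≤ 4 * (j + 1) * Z + Z + 2 * (j + 1) * Z + 8 * C * Z :=
      (abs_add_le _ _).trans (add_le_add ((abs_add_le _ _).trans
        (add_le_add ((abs_add_le _ _).trans (add_le_add e1 e2)) e3)) e4)
    rw [hdec]
    refine hfin.trans ?_
    have : 0 ≤ (j + 1 : ℝ) * Z := by positivity
    nlinarith

/-- Adding an independent centred summand changes a moment only by second order terms. -/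
theorem exists_sum_norm_add_pow_le (j : ℕ) : ∃ C : ℝ, 0 ≤ C ∧ ∀ (L : ℕ) [NeZero L] (q p : ℕ)
    (S X : ZMod L → ℂ) (R v : ℝ), q.Coprime p → Function.Periodic S (q : ZMod L) →
    Function.Periodic X (p : ZMod L) → ∑ x, X x = 0 → ∑ x, ‖X x‖ ^ 2 = L * v →
    (∀ x, ‖X x‖ ^ 2 ≤ R * v) →
    ∑ x, ‖S x + X x‖ ^ (2 * (j + 1)) ≤ ∑ x, ‖S x‖ ^ (2 * (j + 1)) +
      C * ((∑ x, ‖S x‖ ^ (2 * j)) * v + L * (R ^ j * v ^ (j + 1))) := by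
  obtain ⟨C, hC, hT⟩ := exists_abs_add_add_pow_sub_le j
  refine ⟨C, hC, fun L _ q p S X R v hqp hS hX hX0 hXv hXR => ?_⟩
  have hL : (0 : ℝ) < L := Nat.cast_pos.mpr (NeZero.pos L)
  set l : ZMod L → ℝ := fun x => 2 * ((starRingEnd ℂ (S x)) * X x).re with hl
  have hexp : ∀ x, ‖S x + X x‖ ^ 2 = ‖S x‖ ^ 2 + l x + ‖X x‖ ^ 2 := by
    intro x
    simp only [hl, Complex.sq_norm, Complex.normSq_apply, Complex.add_re, Complex.add_im,
      Complex.mul_re, Complex.conj_re, Complex.conj_im]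
    ring
  have hl2 : ∀ x, l x ^ 2 ≤ 4 * (‖S x‖ ^ 2 * ‖X x‖ ^ 2) := by
    intro x
    have h := Complex.abs_re_le_norm ((starRingEnd ℂ (S x)) * X x)
    rw [norm_mul, RCLike.norm_conj] at h
    have h2 := pow_le_pow_left₀ (abs_nonneg _) h 2
    rw [sq_abs] at h2
    simp only [hl]
    nlinarith
  have hpt : ∀ x, ‖S x + X x‖ ^ (2 * (j + 1)) ≤ ‖S x‖ ^ (2 * (j + 1)) +
      (j + 1) * (‖S x‖ ^ (2 * j) * l x) +
      C * (‖S x‖ ^ (2 * j) * ‖X x‖ ^ 2 + (R * v) ^ j * ‖X x‖ ^ 2) := by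
    intro x
    have h := (abs_le.mp (hT _ _ (l x) (sq_nonneg ‖S x‖) (sq_nonneg ‖X x‖) (hl2 x))).2
    rw [← hexp] at h
    simp only [← pow_mul] at h
    have h3 : ‖X x‖ ^ (2 * (j + 1)) ≤ (R * v) ^ j * ‖X x‖ ^ 2 := by
      rw [mul_add, pow_add, mul_one, pow_mul]
      gcongr
      exact hXR x
    have h4 := mul_le_mul_of_nonneg_left (add_le_add_right h3 (‖S x‖ ^ (2 * j) * ‖X x‖ ^ 2)) hC
    linarith
  have hlin : ∑ x, ‖S x‖ ^ (2 * j) * l x = 0 := by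
    have h1 : (L : ℂ) * ∑ x, ((‖S x‖ : ℂ) ^ (2 * j) * starRingEnd ℂ (S x)) * X x = 0 := by
      rw [card_mul_sum_mul_of_coprime_periods hqp (fun x => by rw [hS x]) hX, hX0, mul_zero]
    have h2 := (mul_eq_zero.mp h1).resolve_left (by exact_mod_cast hL.ne')
    have h3 := congrArg (fun z : ℂ => 2 * z.re) h2
    simp only [Complex.re_sum, Finset.mul_sum, Complex.zero_re, mul_zero] at h3
    rw [← h3]
    refine Finset.sum_congr rfl fun x _ => ?_
    rw [mul_assoc, ← Complex.ofReal_pow, Complex.re_ofReal_mul]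
    simp only [hl]
    ring
  have hquad : ∑ x, ‖S x‖ ^ (2 * j) * ‖X x‖ ^ 2 = (∑ x, ‖S x‖ ^ (2 * j)) * v := by
    have h1 : (L : ℝ) * ∑ x, ‖S x‖ ^ (2 * j) * ‖X x‖ ^ 2 = _ :=
      card_mul_sum_mul_of_coprime_periods hqp (fun x => by rw [hS x]) (fun x => by rw [hX x])
    rw [hXv] at h1
    apply mul_left_cancel₀ hL.ne'
    rw [h1]
    ring
  calc ∑ x, ‖S x + X x‖ ^ (2 * (j + 1)) ≤ ∑ x, (‖S x‖ ^ (2 * (j + 1)) +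
      (j + 1) * (‖S x‖ ^ (2 * j) * l x) +
      C * (‖S x‖ ^ (2 * j) * ‖X x‖ ^ 2 + (R * v) ^ j * ‖X x‖ ^ 2)) :=
        Finset.sum_le_sum fun x _ => hpt x
    _ = _ := by
      simp only [Finset.sum_add_distrib, ← Finset.mul_sum]
      rw [hlin, hquad, hXv]
      ring

theorem sum_periodic_prod {L : ℕ} {s : Finset ℕ} {Y : ℕ → ZMod L → ℂ}
    (hY : ∀ p ∈ s, Function.Periodic (Y p) (p : ZMod L)) :
    Function.Periodic (fun x => ∑ p ∈ s, Y p x) ((∏ p ∈ s, p : ℕ) : ZMod L) := by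
  intro x
  refine Finset.sum_congr rfl fun p hp => ?_
  obtain ⟨c, hc⟩ := Finset.dvd_prod_of_mem (fun p : ℕ => p) hp
  have := (hY p hp).nat_mul c x
  rw [hc, Nat.cast_mul, mul_comm]
  exact this

/-- A Rosenthal type bound for even moments of sums of independent centred functions. -/
theorem exists_moment_le (j : ℕ) : ∃ C : ℝ, 0 ≤ C ∧ ∀ (L : ℕ) [NeZero L] (R : ℕ) (s : Finset ℕ)
    (Y : ℕ → ZMod L → ℂ) (v : ℕ → ℝ), (∀ p ∈ s, p.Prime) → s.card ≤ R →
    (∀ p ∈ s, Function.Periodic (Y p) (p : ZMod L)) → (∀ p ∈ s, ∑ x, Y p x = 0) →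
    (∀ p ∈ s, ∑ x, ‖Y p x‖ ^ 2 = L * v p) → (∀ p ∈ s, ∀ x, ‖Y p x‖ ^ 2 ≤ R * v p) →
    (∀ p ∈ s, 0 ≤ v p) →
    ∑ x, ‖∑ p ∈ s, Y p x‖ ^ (2 * (j + 1)) ≤ C * (L * (R ^ j * ∑ p ∈ s, v p ^ (j + 1))) := by
  have key : ∀ j : ℕ, ∃ C : ℝ, 0 ≤ C ∧ ∀ (L : ℕ) [NeZero L] (R : ℕ) (s : Finset ℕ)
      (Y : ℕ → ZMod L → ℂ) (v : ℕ → ℝ) (B : ℝ), (∀ p ∈ s, p.Prime) →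
      (∀ p ∈ s, Function.Periodic (Y p) (p : ZMod L)) → (∀ p ∈ s, ∑ x, Y p x = 0) →
      (∀ p ∈ s, ∑ x, ‖Y p x‖ ^ 2 = L * v p) → (∀ p ∈ s, ∀ x, ‖Y p x‖ ^ 2 ≤ R * v p) →
      (∀ p ∈ s, 0 ≤ v p) → (∀ t ⊆ s, ∑ x, ‖∑ p ∈ t, Y p x‖ ^ (2 * j) ≤ B) →
      ∑ x, ‖∑ p ∈ s, Y p x‖ ^ (2 * (j + 1)) ≤
        C * (B * ∑ p ∈ s, v p + L * (R ^ j * ∑ p ∈ s, v p ^ (j + 1))) := by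
    intro j
    obtain ⟨C, hC, hstep⟩ := exists_sum_norm_add_pow_le j
    refine ⟨C, hC, fun L _ R s Y v B => ?_⟩
    induction s using Finset.induction_on with
    | empty => intros; simp
    | insert p s hp ih =>
      intro hs hY hY0 hYv hYR hv hB
      simp only [Finset.forall_mem_insert] at hs hY hY0 hYv hYR hv
      have ih' := ih hs.2 hY.2 hY0.2 hYv.2 hYR.2 hv.2
        (fun t ht => hB t (ht.trans (Finset.subset_insert p s)))
      have hcop : (∏ p ∈ s, p).Coprime p := Nat.Coprime.prod_left fun r hr =>
        (Nat.coprime_primes (hs.2 r hr) hs.1).mpr (fun h => hp (h ▸ hr))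
      have h := hstep L _ p (fun x => ∑ p ∈ s, Y p x) (Y p) R (v p) hcop (sum_periodic_prod hY.2)
        hY.1 hY0.1 hYv.1 hYR.1
      have hBs := hB s (Finset.subset_insert p s)
      simp only [Finset.sum_insert hp]
      calc ∑ x, ‖Y p x + ∑ p ∈ s, Y p x‖ ^ (2 * (j + 1))
          = ∑ x, ‖(∑ p ∈ s, Y p x) + Y p x‖ ^ (2 * (j + 1)) := by simp only [add_comm]
        _ ≤ _ := h
        _ ≤ C * (B * ∑ p ∈ s, v p + L * (R ^ j * ∑ p ∈ s, v p ^ (j + 1))) +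
            C * (B * v p + L * (R ^ j * v p ^ (j + 1))) := by
          have := hv.1
          gcongr
        _ = _ := by ring
  induction j with
  | zero =>
    obtain ⟨C, hC, h⟩ := key 0
    refine ⟨2 * C, by positivity, fun L _ R s Y v hs _ hY hY0 hYv hYR hv => ?_⟩
    refine (h L R s Y v L hs hY hY0 hYv hYR hv (fun t _ => by simp [ZMod.card])).trans (le_of_eq ?_)
    simp only [zero_add, pow_one, pow_zero]
    ring
  | succ j ih =>
    obtain ⟨C, hC, h⟩ := key (j + 1)
    obtain ⟨C', hC', ih⟩ := ih
    refine ⟨C * (C' + 1), by positivity, fun L _ R s Y v hs hsR hY hY0 hYv hYR hv => ?_⟩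
    refine (h L R s Y v (C' * (L * (R ^ j * ∑ p ∈ s, v p ^ (j + 1)))) hs hY hY0 hYv hYR hv
      (fun t ht => ?_)).trans ?_
    · refine (ih L R t Y v (fun p hp => hs p (ht hp)) ((Finset.card_le_card ht).trans hsR)
        (fun p hp => hY p (ht hp)) (fun p hp => hY0 p (ht hp)) (fun p hp => hYv p (ht hp))
        (fun p hp => hYR p (ht hp)) (fun p hp => hv p (ht hp))).trans ?_
      have : ∑ p ∈ t, v p ^ (j + 1) ≤ ∑ p ∈ s, v p ^ (j + 1) :=
        Finset.sum_le_sum_of_subset_of_nonneg ht fun p hp _ => pow_nonneg (hv p hp) _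
      gcongr
    · have hcheb : (∑ p ∈ s, v p ^ (j + 1)) * ∑ p ∈ s, v p ≤ R * ∑ p ∈ s, v p ^ (j + 2) := by
        have h1 := ((monovaryOn_self v (s : Set ℕ)).pow_left₀ (fun p hp => hv p hp)
          (j + 1)).sum_mul_sum_le_card_mul_sum
        simp only [Pi.pow_apply, ← pow_succ] at h1
        refine h1.trans ?_
        have : 0 ≤ ∑ p ∈ s, v p ^ (j + 2) := Finset.sum_nonneg fun p hp => pow_nonneg (hv p hp) _
        gcongr
      calc _ = C * (C' * (L * (R ^ j * ((∑ p ∈ s, v p ^ (j + 1)) * ∑ p ∈ s, v p))) +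
            L * (R ^ (j + 1) * ∑ p ∈ s, v p ^ (j + 1 + 1))) := by ring
        _ ≤ C * (C' * (L * (R ^ j * (R * ∑ p ∈ s, v p ^ (j + 2)))) +
            L * (R ^ (j + 1) * ∑ p ∈ s, v p ^ (j + 1 + 1))) := by gcongr
        _ = _ := by ring

/-- The span of the functions on `ℤ/L` having a positive period at most `M`. -/
def periodicSpan (L M : ℕ) : Submodule ℂ (ZMod L → ℂ) :=
  Submodule.span ℂ {h | ∃ q : ℕ, 0 < q ∧ q ≤ M ∧ Function.Periodic h (q : ZMod L)}

theorem mul_mem_periodicSpan {L A B : ℕ} {f g : ZMod L → ℂ} (hf : f ∈ periodicSpan L A)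
    (hg : g ∈ periodicSpan L B) : f * g ∈ periodicSpan L (A * B) := by
  have h := Submodule.mul_mem_mul hf hg
  rw [periodicSpan, periodicSpan, Submodule.span_mul_span] at h
  refine Submodule.span_mono ?_ h
  rintro _ ⟨a, ⟨q, hq, hqA, ha⟩, b, ⟨r, hr, hrB, hb⟩, rfl⟩
  refine ⟨q * r, Nat.mul_pos hq hr, Nat.mul_le_mul hqA hrB, ?_⟩
  have h1 := ha.nat_mul r
  have h2 := hb.nat_mul q
  rw [mul_comm] at h1
  rw [Nat.cast_mul]
  exact h1.mul h2

theorem pow_mem_periodicSpan {L A : ℕ} {f : ZMod L → ℂ} (hf : f ∈ periodicSpan L A) (k : ℕ) :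
    f ^ k ∈ periodicSpan L (A ^ k) := by
  induction k with
  | zero => exact Submodule.subset_span ⟨1, one_pos, by simp, fun x => by simp⟩
  | succ k ih => rw [pow_succ, pow_succ]; exact mul_mem_periodicSpan ih hf

/-- A Fejér kernel on `ℤ/L` with few frequencies is uncorrelated with functions of small period. -/
theorem sum_fejer_mul {L D M : ℕ} [NeZero L] (hL : D * M ≤ L) {h : ZMod L → ℂ}
    (hh : h ∈ periodicSpan L M) :
    ∑ x, ((‖∑ i ∈ Finset.range D, ZMod.stdAddChar ((i : ZMod L) * x)‖ ^ 2 : ℝ) : ℂ) * h x =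
      D * ∑ x, h x := by
  induction hh using Submodule.span_induction with
  | zero => simp
  | add f g _ _ hf hg => simp only [Pi.add_apply, mul_add, Finset.sum_add_distrib, hf, hg]
  | smul c f _ hf =>
    simp only [Pi.smul_apply, smul_eq_mul, mul_left_comm _ c, ← Finset.mul_sum, hf]
  | mem h hh =>
    obtain ⟨q, hq, hqM, hh⟩ := hh
    have hoff : ∀ i ∈ Finset.range D, ∀ i' ∈ Finset.range D,
        ∑ x, ZMod.stdAddChar (((i : ZMod L) - (i' : ZMod L)) * x) * h x =
          if i = i' then ∑ x, h x else 0 := by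
      intro i hi i' hi'
      rw [Finset.mem_range] at hi hi'
      split_ifs with hii
      · simp [hii]
      set χ : ZMod L → ℂ := fun x => ZMod.stdAddChar (((i : ZMod L) - (i' : ZMod L)) * x) with hχ
      have hne : ((i : ZMod L) - (i' : ZMod L)) * q ≠ 0 := by
        intro h0
        have h1 : ((((i : ℤ) - i') * q : ℤ) : ZMod L) = 0 := by push_cast; exact h0
        rw [ZMod.intCast_zmod_eq_zero_iff_dvd] at h1
        have h2 : |((i : ℤ) - i')| < D := by rw [abs_lt]; constructor <;> omega
        have h3 : |((i : ℤ) - i') * q| < L := by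
          rw [abs_mul, Nat.abs_cast]
          calc |((i : ℤ) - i')| * q < D * q := by gcongr
            _ ≤ D * M := by gcongr
            _ ≤ L := by exact_mod_cast hL
        have h4 := Int.eq_zero_of_abs_lt_dvd h1 h3
        rcases mul_eq_zero.mp h4 with h5 | h5 <;> omega
      have hχq : ZMod.stdAddChar (((i : ZMod L) - (i' : ZMod L)) * (q : ZMod L)) ≠ (1 : ℂ) := by
        intro h1
        apply hne
        apply ZMod.injective_stdAddChar
        rw [h1, AddChar.map_zero_eq_one]
      have h1 : ∑ x, χ x * h x =
          ZMod.stdAddChar (((i : ZMod L) - (i' : ZMod L)) * (q : ZMod L)) * ∑ x, χ x * h x := by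
        conv_lhs => rw [← Equiv.sum_comp (Equiv.addRight (q : ZMod L)) (fun x => χ x * h x)]
        rw [Finset.mul_sum]
        refine Finset.sum_congr rfl fun x _ => ?_
        simp only [Equiv.coe_addRight, hχ, hh x, mul_add, AddChar.map_add_eq_mul]
        ring
      by_contra hne0
      exact hχq (mul_right_cancel₀ hne0 (by rw [one_mul]; exact h1.symm))
    have hsq : ∀ x : ZMod L,
        ((‖∑ i ∈ Finset.range D, ZMod.stdAddChar ((i : ZMod L) * x)‖ ^ 2 : ℝ) : ℂ) =
        ∑ i ∈ Finset.range D, ∑ i' ∈ Finset.range D,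
          ZMod.stdAddChar (((i : ZMod L) - (i' : ZMod L)) * x) := by
      intro x
      rw [Complex.ofReal_pow, ← Complex.mul_conj', map_sum, Finset.sum_mul_sum]
      refine Finset.sum_congr rfl fun i _ => Finset.sum_congr rfl fun i' _ => ?_
      rw [← AddChar.map_neg_eq_conj, ← AddChar.map_add_eq_mul]
      congr 1
      ring
    simp only [hsq, Finset.sum_mul]
    rw [Finset.sum_comm]
    have : ∀ i ∈ Finset.range D, ∑ x : ZMod L, ∑ i' ∈ Finset.range D,
        ZMod.stdAddChar (((i : ZMod L) - (i' : ZMod L)) * x) * h x = ∑ x, h x := by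
      intro i hi
      rw [Finset.sum_comm, Finset.sum_congr rfl (hoff i hi)]
      simp [Finset.mem_range.mp hi]
    rw [Finset.sum_congr rfl this]
    simp

theorem re_stdAddChar_ge_half {L m : ℕ} [NeZero L] (hm : 8 * m ≤ L) :
    1 / 2 ≤ (ZMod.stdAddChar (m : ZMod L) : ℂ).re := by
  have hL : (0 : ℝ) < L := Nat.cast_pos.mpr (NeZero.pos L)
  have h1 : (ZMod.stdAddChar (m : ZMod L) : ℂ) = Complex.exp ((2 * π * m / L : ℝ) * Complex.I) := by
    have := ZMod.stdAddChar_coe (N := L) (m : ℤ)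
    push_cast at this ⊢
    rw [this]
    ring_nf
  rw [h1, Complex.exp_ofReal_mul_I_re, ← Real.cos_pi_div_three]
  have h8 : (8 * m : ℝ) ≤ L := by exact_mod_cast hm
  apply Real.cos_le_cos_of_nonneg_of_le_pi (by positivity) (by linarith [Real.pi_pos])
  rw [div_le_iff₀ hL]
  nlinarith [Real.pi_pos, mul_le_mul_of_nonneg_left h8 Real.pi_pos.le]

/-- A sum over a short interval of an even power of a combination of functions of small period is
controlled by the mean value. -/
theorem sum_Icc_norm_pow_le {L M D R k N : ℕ} [NeZero L] (hLdef : L = 8 * M * D)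
    (hD : 0 < D) (hN : N ≤ M)
    (hR : R ^ (2 * k) ≤ M) {s : Finset ℕ} (hs : ∀ p ∈ s, 0 < p ∧ p ≤ R)
    {Y : ℕ → ZMod L → ℂ}
    (hY : ∀ p ∈ s, Function.Periodic (Y p) (p : ZMod L)) :
    D * ∑ n ∈ Finset.Icc 1 N, ‖∑ p ∈ s, Y p (n : ZMod L)‖ ^ (2 * k) ≤
      4 * ∑ x, ‖∑ p ∈ s, Y p x‖ ^ (2 * k) := by
  set w : ZMod L → ℝ := fun x => ‖∑ i ∈ Finset.range D, ZMod.stdAddChar ((i : ZMod L) * x)‖ ^ 2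
    with hw
  set G : ZMod L → ℂ := ∑ p ∈ s, Y p with hG
  have hGx : ∀ x, ∑ p ∈ s, Y p x = G x := fun x => by rw [hG, Finset.sum_apply]
  simp only [hGx]
  have hG1 : G ∈ periodicSpan L R := Submodule.sum_mem _ fun p hp =>
    Submodule.subset_span ⟨p, (hs p hp).1, (hs p hp).2, hY p hp⟩
  have hG2 : star G ∈ periodicSpan L R := by
    rw [hG, star_sum]
    refine Submodule.sum_mem _ fun p hp =>
      Submodule.subset_span ⟨p, (hs p hp).1, (hs p hp).2, fun x => ?_⟩
    rw [Pi.star_apply, Pi.star_apply, hY p hp x]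
  have hH : (G * star G) ^ k ∈ periodicSpan L M := by
    have := pow_mem_periodicSpan (mul_mem_periodicSpan hG1 hG2) k
    rw [← sq, ← pow_mul] at this
    refine Submodule.span_mono ?_ this
    rintro h ⟨q, hq, hqR, hh⟩
    exact ⟨q, hq, hqR.trans hR, hh⟩
  have hHx : ∀ x, ((G * star G) ^ k) x = ((‖G x‖ ^ (2 * k) : ℝ) : ℂ) := by
    intro x
    rw [Pi.pow_apply, Pi.mul_apply, Pi.star_apply, Complex.star_def, Complex.mul_conj',
      ← pow_mul, Complex.ofReal_pow]
  have hDM : D * M ≤ L := by rw [hLdef]; nlinarith [Nat.zero_le (M * D)]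
  have hmain : ∑ x, w x * ‖G x‖ ^ (2 * k) = D * ∑ x, ‖G x‖ ^ (2 * k) := by
    have := sum_fejer_mul hDM hH
    simp only [hHx] at this
    exact_mod_cast this
  have hwn : ∀ n ∈ Finset.Icc 1 N, (D : ℝ) ^ 2 / 4 ≤ w (n : ZMod L) := by
    intro n hn
    rw [Finset.mem_Icc] at hn
    have h1 : (D : ℝ) / 2 ≤
        ‖∑ i ∈ Finset.range D, ZMod.stdAddChar ((i : ZMod L) * (n : ZMod L))‖ := by
      refine le_trans ?_ (Complex.re_le_norm _)
      rw [Complex.re_sum]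
      have : ∑ i ∈ Finset.range D, (1 / 2 : ℝ) = D / 2 := by simp; ring
      rw [← this]
      refine Finset.sum_le_sum fun i hi => ?_
      rw [← Nat.cast_mul]
      apply re_stdAddChar_ge_half
      rw [Finset.mem_range] at hi
      calc 8 * (i * n) ≤ 8 * (D * M) :=
          Nat.mul_le_mul_left 8 (Nat.mul_le_mul hi.le (hn.2.trans hN))
        _ = L := by rw [hLdef]; ring
    calc (D : ℝ) ^ 2 / 4 = (D / 2) ^ 2 := by ring
      _ ≤ _ := pow_le_pow_left₀ (by positivity) h1 2
  have hinj : ∑ n ∈ Finset.Icc 1 N, w (n : ZMod L) * ‖G (n : ZMod L)‖ ^ (2 * k) ≤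
      ∑ x, w x * ‖G x‖ ^ (2 * k) := by
    have hi : Set.InjOn (fun n : ℕ => (n : ZMod L)) (Finset.Icc 1 N) := by
      intro a ha b hb hab
      simp only [Finset.coe_Icc, Set.mem_Icc] at ha hb
      have hNL : N < L := by
        have : 0 < M := by omega
        rw [hLdef]
        nlinarith [Nat.mul_pos this hD, Nat.mul_le_mul_left M hD]
      have := congrArg ZMod.val hab
      simpa [ZMod.val_natCast, Nat.mod_eq_of_lt (ha.2.trans_lt hNL),
        Nat.mod_eq_of_lt (hb.2.trans_lt hNL)] using this
    rw [← Finset.sum_image (f := fun x : ZMod L => w x * ‖G x‖ ^ (2 * k)) hi]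
    exact Finset.sum_le_sum_of_subset_of_nonneg (Finset.subset_univ _) fun x _ _ => by
      simp only [hw]; positivity
  have hDpos : (0 : ℝ) < D := Nat.cast_pos.mpr hD
  have hfin : (D : ℝ) ^ 2 / 4 * ∑ n ∈ Finset.Icc 1 N, ‖G (n : ZMod L)‖ ^ (2 * k) ≤
      D * ∑ x, ‖G x‖ ^ (2 * k) := by
    rw [← hmain, Finset.mul_sum]
    refine le_trans (Finset.sum_le_sum fun n hn => ?_) hinj
    exact mul_le_mul_of_nonneg_right (hwn n hn) (by positivity)
  refine le_of_mul_le_mul_left ?_ (by positivity : (0 : ℝ) < D / 4)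
  calc _ = (D : ℝ) ^ 2 / 4 * ∑ n ∈ Finset.Icc 1 N, ‖G (n : ZMod L)‖ ^ (2 * k) := by ring
    _ ≤ _ := hfin
    _ = _ := by ring

theorem sum_norm_sq_sum_mul_stdAddChar {L : ℕ} [NeZero L] {ι : Type*} {s : Finset ι}
    {g : ι → ZMod L} (hg : Set.InjOn g s) (c : ι → ℂ) :
    ∑ x, ‖∑ a ∈ s, c a * ZMod.stdAddChar (g a * x)‖ ^ 2 = L * ∑ a ∈ s, ‖c a‖ ^ 2 := by
  classical
  have hsq : ∀ x : ZMod L, ((‖∑ a ∈ s, c a * ZMod.stdAddChar (g a * x)‖ ^ 2 : ℝ) : ℂ) =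
      ∑ a ∈ s, ∑ b ∈ s, c a * starRingEnd ℂ (c b) * ZMod.stdAddChar (x * (g a - g b)) := by
    intro x
    rw [Complex.ofReal_pow, ← Complex.mul_conj', map_sum, Finset.sum_mul_sum]
    refine Finset.sum_congr rfl fun a _ => Finset.sum_congr rfl fun b _ => ?_
    rw [map_mul (starRingEnd ℂ), ← AddChar.map_neg_eq_conj, mul_mul_mul_comm,
      ← AddChar.map_add_eq_mul]
    congr 2
    ring
  have h : ((∑ x, ‖∑ a ∈ s, c a * ZMod.stdAddChar (g a * x)‖ ^ 2 : ℝ) : ℂ) =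
      ((L * ∑ a ∈ s, ‖c a‖ ^ 2 : ℝ) : ℂ) := by
    rw [Complex.ofReal_sum, Finset.sum_congr rfl fun x _ => hsq x, Finset.sum_comm,
      Complex.ofReal_mul, Complex.ofReal_sum, Finset.mul_sum]
    refine Finset.sum_congr rfl fun a ha => ?_
    rw [Finset.sum_comm]
    simp only [← Finset.mul_sum, AddChar.sum_mulShift _ (ZMod.isPrimitive_stdAddChar L)]
    rw [Finset.sum_eq_single_of_mem a ha]
    · simp only [sub_self, if_true, ZMod.card, Complex.mul_conj', Complex.ofReal_pow,
        Complex.ofReal_natCast]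
      ring
    · intro b hb hba
      rw [if_neg (sub_ne_zero.mpr fun h => hba (hg hb ha h.symm))]
      simp
  exact_mod_cast h

/-- The function on `ℤ/L` whose frequencies are the `a / p` with `0 < a < p`, with coefficients
given by the Fourier transform of `f`. -/
noncomputable def fareyPart (L N : ℕ) [NeZero L] (f : ℕ → ℂ) (p : ℕ) (x : ZMod L) : ℂ :=
  ∑ a ∈ Finset.Icc 1 (p - 1),
    fourierT N f ((a : ℝ) / p) * ZMod.stdAddChar (((a * (L / p) : ℕ) : ZMod L) * x)

section FareyPart

variable {L N p : ℕ} [NeZero L] {f : ℕ → ℂ}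

theorem fareyPart_periodic (hpL : p ∣ L) :
    Function.Periodic (fareyPart L N f p) (p : ZMod L) := by
  intro x
  refine Finset.sum_congr rfl fun a _ => ?_
  have h : ((a * (L / p) : ℕ) : ZMod L) * (p : ZMod L) = 0 := by
    rw [← Nat.cast_mul, mul_assoc, Nat.div_mul_cancel hpL]
    simp
  rw [mul_add, h, add_zero]

theorem injOn_natCast_mul_div (hpL : p ∣ L) :
    Set.InjOn (fun a : ℕ => ((a * (L / p) : ℕ) : ZMod L)) (Set.Iio p) := by
  have hL := NeZero.pos L
  have hdiv : 0 < L / p := Nat.div_pos (Nat.le_of_dvd hL hpL) (Nat.pos_of_dvd_of_pos hpL hL)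
  have hlt : ∀ a < p, a * (L / p) < L := fun a ha =>
    (Nat.mul_lt_mul_of_pos_right ha hdiv).trans_eq (Nat.mul_div_cancel' hpL)
  intro a ha b hb hab
  have h := congrArg ZMod.val hab
  simp only [ZMod.val_natCast, Nat.mod_eq_of_lt (hlt a ha), Nat.mod_eq_of_lt (hlt b hb)] at h
  exact Nat.eq_of_mul_eq_mul_right hdiv h

theorem sum_fareyPart (hpL : p ∣ L) : ∑ x, fareyPart L N f p x = 0 := by
  classical
  simp only [fareyPart]
  rw [Finset.sum_comm]
  refine Finset.sum_eq_zero fun a ha => ?_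
  rw [Finset.mem_Icc] at ha
  simp only [← Finset.mul_sum, mul_comm ((a * (L / p) : ℕ) : ZMod L),
    AddChar.sum_mulShift _ (ZMod.isPrimitive_stdAddChar L)]
  rw [if_neg, Nat.cast_zero, mul_zero]
  intro h
  have h0 : a = 0 := injOn_natCast_mul_div hpL (by rw [Set.mem_Iio]; omega)
    (by rw [Set.mem_Iio]; omega) (by simpa using h)
  omega

theorem sum_norm_sq_fareyPart (hpL : p ∣ L) :
    ∑ x, ‖fareyPart L N f p x‖ ^ 2 = L * Ip N f p := by
  refine sum_norm_sq_sum_mul_stdAddChar ((injOn_natCast_mul_div hpL).mono ?_) _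
  intro a ha
  simp only [Finset.coe_Icc, Set.mem_Icc] at ha
  rw [Set.mem_Iio]
  omega

theorem Ip_nonneg : 0 ≤ Ip N f p := Finset.sum_nonneg fun _ _ => sq_nonneg _

theorem norm_sq_fareyPart_le (x : ZMod L) : ‖fareyPart L N f p x‖ ^ 2 ≤ p * Ip N f p := by
  have h1 : ‖fareyPart L N f p x‖ ≤ ∑ a ∈ Finset.Icc 1 (p - 1), ‖fourierT N f ((a : ℝ) / p)‖ := by
    refine (norm_sum_le _ _).trans_eq (Finset.sum_congr rfl fun a _ => ?_)
    rw [norm_mul, AddChar.norm_apply, mul_one]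
  calc ‖fareyPart L N f p x‖ ^ 2
      ≤ (∑ a ∈ Finset.Icc 1 (p - 1), ‖fourierT N f ((a : ℝ) / p)‖) ^ 2 := by gcongr
    _ ≤ (Finset.Icc 1 (p - 1)).card * Ip N f p := sq_sum_le_card_mul_sum_sq
    _ ≤ p * Ip N f p := by
      have := Ip_nonneg (N := N) (p := p) (f := f)
      gcongr
      simp

theorem sum_mul_conj_fareyPart (hpL : p ∣ L) :
    ∑ n ∈ Finset.Icc 1 N, f n * starRingEnd ℂ (fareyPart L N f p n) = (Ip N f p : ℂ) := by
  have hχ : ∀ a n : ℕ, starRingEnd ℂ (ZMod.stdAddChar (((a * (L / p) : ℕ) : ZMod L) * (n : ZMod L)))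
      = Complex.exp (-(2 * π * Complex.I * ((a : ℝ) / p : ℝ) * n)) := by
    intro a n
    have hL : (L : ℂ) ≠ 0 := Nat.cast_ne_zero.mpr (NeZero.ne L)
    have hp : (p : ℂ) ≠ 0 := by
      rintro h
      rw [Nat.cast_eq_zero] at h
      exact NeZero.ne L (Nat.eq_zero_of_zero_dvd (h ▸ hpL))
    have hdiv : ((L / p : ℕ) : ℂ) = L / p := Nat.cast_div hpL hp
    obtain ⟨m, hm⟩ : ∃ m, m = a * (L / p) * n := ⟨_, rfl⟩
    have h : -((m : ℕ) : ZMod L) = ((-(m : ℤ) : ℤ) : ZMod L) := by push_cast; rfl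
    rw [← AddChar.map_neg_eq_conj, ← Nat.cast_mul, ← hm, h, ZMod.stdAddChar_coe]
    congr 1
    rw [Int.cast_neg, Int.cast_natCast, hm, Nat.cast_mul, Nat.cast_mul, hdiv, Complex.ofReal_div,
      Complex.ofReal_natCast, Complex.ofReal_natCast]
    field_simp
  simp only [fareyPart, map_sum, map_mul, Finset.mul_sum, hχ]
  rw [Finset.sum_comm, Ip, Complex.ofReal_sum]
  refine Finset.sum_congr rfl fun a _ => ?_
  rw [Complex.ofReal_pow, ← Complex.conj_mul']
  calc _ = starRingEnd ℂ (fourierT N f ((a : ℝ) / p)) * ∑ n ∈ Finset.Icc 1 N,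
      f n * Complex.exp (-(2 * π * Complex.I * ((a : ℝ) / p : ℝ) * n)) := by
        rw [Finset.mul_sum]
        exact Finset.sum_congr rfl fun n _ => by ring
    _ = _ := rfl

end FareyPart

/-- The dual form of the inequality: a function `g` correlating with `f`, of small `L^{2k}` norm. -/
theorem exists_dual_function (j : ℕ) : ∃ C : ℝ, 0 ≤ C ∧ ∀ N : ℕ, 1 ≤ N → ∀ (P : ℝ) (f : ℕ → ℂ)
    (c : ℕ → ℝ), ∃ g : ℕ → ℂ,
    ∑ n ∈ Finset.Icc 1 N, f n * g n = ((∑ p ∈ primesUpTo P, c p * Ip N f p : ℝ) : ℂ) ∧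
    ∑ n ∈ Finset.Icc 1 N, ‖g n‖ ^ (2 * (j + 1)) ≤ C * ((N + (⌊P⌋₊ : ℝ) ^ (2 * (j + 1))) *
      ((⌊P⌋₊ : ℝ) ^ j * ∑ p ∈ primesUpTo P, (c p ^ 2 * Ip N f p) ^ (j + 1))) := by
  obtain ⟨C, hC, hmoment⟩ := exists_moment_le j
  refine ⟨32 * C, by positivity, fun N hN P f c => ?_⟩
  set R := ⌊P⌋₊ with hR
  set s := primesUpTo P with hs
  have hsp : ∀ p ∈ s, p.Prime ∧ p ≤ R := by
    intro p hp
    rw [hs, primesUpTo, Finset.mem_filter, Finset.mem_range] at hp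
    exact ⟨hp.2, by omega⟩
  have hcard : s.card ≤ R := by
    have : s ⊆ Finset.Icc 1 R := fun p hp =>
      Finset.mem_Icc.mpr ⟨(hsp p hp).1.one_le, (hsp p hp).2⟩
    simpa using Finset.card_le_card this
  set M := N + R ^ (2 * (j + 1)) with hM
  set D := R.factorial with hD
  have hDpos : 0 < D := R.factorial_pos
  obtain ⟨L, hL⟩ : ∃ L, L = 8 * M * D := ⟨_, rfl⟩
  have : NeZero L := ⟨by rw [hL]; positivity⟩
  have hpL : ∀ p ∈ s, p ∣ L := fun p hp => by
    rw [hL]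
    exact Dvd.dvd.mul_left (Nat.dvd_factorial (hsp p hp).1.pos (hsp p hp).2) _
  set Y : ℕ → ZMod L → ℂ := fun p x => c p * fareyPart L N f p x with hY
  have hYper : ∀ p ∈ s, Function.Periodic (Y p) (p : ZMod L) := fun p hp x => by
    simp only [hY, fareyPart_periodic (hpL p hp) x]
  have hYnorm : ∀ p x, ‖Y p x‖ ^ 2 = c p ^ 2 * ‖fareyPart L N f p x‖ ^ 2 := by
    intro p x
    simp only [hY, norm_mul, mul_pow, Complex.norm_real, Real.norm_eq_abs, sq_abs]
  refine ⟨fun n => starRingEnd ℂ (∑ p ∈ s, Y p n), ?_, ?_⟩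
  · simp only [hY, map_sum, map_mul, Complex.conj_ofReal, Finset.mul_sum]
    rw [Finset.sum_comm, Complex.ofReal_sum]
    refine Finset.sum_congr rfl fun p hp => ?_
    rw [Complex.ofReal_mul, ← sum_mul_conj_fareyPart (hpL p hp), Finset.mul_sum]
    exact Finset.sum_congr rfl fun n _ => by ring
  · simp only [RCLike.norm_conj]
    have h1 := sum_Icc_norm_pow_le (k := j + 1) (N := N) hL hDpos (Nat.le_add_right _ _)
      (Nat.le_add_left (R ^ (2 * (j + 1))) N)
      (fun p hp => ⟨(hsp p hp).1.pos, (hsp p hp).2⟩) hYper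
    have h2 := hmoment L R s Y (fun p => c p ^ 2 * Ip N f p) (fun p hp => (hsp p hp).1) hcard
      hYper
      (fun p hp => by simp only [hY, ← Finset.mul_sum, sum_fareyPart (hpL p hp), mul_zero])
      (fun p hp => by
        simp only [hYnorm, ← Finset.mul_sum, sum_norm_sq_fareyPart (hpL p hp)]; ring)
      (fun p hp x => by
        rw [hYnorm]
        calc c p ^ 2 * ‖fareyPart L N f p x‖ ^ 2 ≤ c p ^ 2 * (R * Ip N f p) := by
              have hpR : (p : ℝ) ≤ R := by exact_mod_cast (hsp p hp).2
              refine mul_le_mul_of_nonneg_left ((norm_sq_fareyPart_le x).trans ?_) (sq_nonneg _)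
              exact mul_le_mul_of_nonneg_right hpR Ip_nonneg
          _ = _ := by ring)
      (fun p _ => mul_nonneg (sq_nonneg _) Ip_nonneg)
    have hD' : (0 : ℝ) < D := Nat.cast_pos.mpr hDpos
    refine le_of_mul_le_mul_left ?_ hD'
    refine h1.trans ((mul_le_mul_of_nonneg_left h2 (by norm_num)).trans_eq ?_)
    rw [hL, hM]
    push_cast
    ring

/-- Conclusion of a duality argument: a self-bounding quantity with conjugate exponents. -/
theorem le_rpow_mul_of_le_rpow_mul_rpow {T F K r : ℝ} (hT : 0 ≤ T) (hF : 0 ≤ F) (hK : 0 ≤ K)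
    (hr : 0 < r) (h : T ≤ F ^ (r / (r + 1)) * (K * T) ^ (1 / (r + 1))) : T ≤ K ^ (1 / r) * F := by
  rcases hT.eq_or_lt with rfl | hT
  · positivity
  have h1 : T ^ (r + 1) ≤ F ^ r * (K * T) := by
    have := Real.rpow_le_rpow hT.le h (by positivity : 0 ≤ r + 1)
    rwa [Real.mul_rpow (by positivity) (by positivity), ← Real.rpow_mul hF,
      ← Real.rpow_mul (by positivity), div_mul_cancel₀ _ (by positivity),
      div_mul_cancel₀ _ (by positivity), Real.rpow_one] at this
  have h2 : T ^ r ≤ K * F ^ r := by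
    rw [Real.rpow_add_one hT.ne'] at h1
    refine le_of_mul_le_mul_right (h1.trans_eq ?_) hT
    ring
  have h3 := Real.rpow_le_rpow (by positivity) h2 (by positivity : 0 ≤ 1 / r)
  rwa [Real.mul_rpow hK (by positivity), ← Real.rpow_mul hT.le, ← Real.rpow_mul hF,
    mul_one_div_cancel hr.ne', Real.rpow_one, Real.rpow_one] at h3

theorem large_sieve_variant (k : ℕ) (hk : 0 < k) :
    ∃ C : ℝ, C > 0 ∧ ∀ N : ℕ, 1 ≤ N → ∀ P : ℝ, 1 ≤ P → ∀ f : ℕ → ℂ,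
      ∑ p ∈ primesUpTo P, (Ip N f p) ^ ((k : ℝ) / (2 * k - 1)) ≤
        C * P ^ (((k : ℝ) - 1) / (2 * k - 1)) *
          ((N : ℝ) ^ ((1 : ℝ) / (2 * k - 1)) + P ^ ((2 * k : ℝ) / (2 * k - 1))) *
          ∑ n ∈ Finset.Icc 1 N, ‖f n‖ ^ ((2 * k : ℝ) / (2 * k - 1)) := by
  obtain ⟨j, rfl⟩ := Nat.exists_eq_succ_of_ne_zero hk.ne'
  obtain ⟨C, hC, hdual⟩ := exists_dual_function j
  obtain ⟨r, hr⟩ : ∃ r : ℝ, r = 2 * j + 1 := ⟨_, rfl⟩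
  have hr0 : 0 < r := by rw [hr]; positivity
  have hr1 : 1 ≤ r := by rw [hr]; linarith [(Nat.cast_nonneg j : (0 : ℝ) ≤ j)]
  have e1 : (2 * ((j.succ : ℕ) : ℝ) - 1) = r := by rw [hr]; push_cast; ring
  have e2 : (2 * ((j.succ : ℕ) : ℝ)) = r + 1 := by rw [hr]; push_cast; ring
  have e3 : ((j.succ : ℕ) : ℝ) - 1 = j := by push_cast; ring
  rw [e1, e2, e3]
  refine ⟨C ^ (1 / r) + 1, by positivity, fun N hN P hP f => ?_⟩
  have hP0 : 0 ≤ P := zero_le_one.trans hP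
  set s := primesUpTo P with hs
  set T := ∑ p ∈ s, Ip N f p ^ ((j.succ : ℕ) / r : ℝ) with hT
  set F := ∑ n ∈ Finset.Icc 1 N, ‖f n‖ ^ ((r + 1) / r) with hF
  have hT0 : 0 ≤ T := Finset.sum_nonneg fun p _ => Real.rpow_nonneg Ip_nonneg _
  have hF0 : 0 ≤ F := Finset.sum_nonneg fun n _ => by positivity
  obtain ⟨g, hfg, hg⟩ := hdual N hN P f (fun p => Ip N f p ^ (-(j / r) : ℝ))
  have hexp : (-(j / r) : ℝ) + 1 = (j.succ : ℕ) / r := by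
    rw [← e3]; field_simp; rw [← e1]; ring
  have hlin : ∀ p, Ip N f p ^ (-(j / r) : ℝ) * Ip N f p = Ip N f p ^ ((j.succ : ℕ) / r : ℝ) := by
    intro p
    rcases (Ip_nonneg (N := N) (f := f) (p := p)).eq_or_lt with h | h
    · rw [← h, mul_zero, Real.zero_rpow (by positivity)]
    · rw [← Real.rpow_add_one h.ne', hexp]
  have hpow : ∀ p, ((Ip N f p ^ (-(j / r) : ℝ)) ^ 2 * Ip N f p) ^ (j + 1) =
      Ip N f p ^ ((j.succ : ℕ) / r : ℝ) := by
    intro p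
    rcases (Ip_nonneg (N := N) (f := f) (p := p)).eq_or_lt with h | h
    · rw [← h, mul_zero, Real.zero_rpow (by positivity), zero_pow (Nat.succ_ne_zero j)]
    · rw [← Real.rpow_mul_natCast h.le, ← Real.rpow_add_one h.ne', ← Real.rpow_mul_natCast h.le]
      congr 1
      rw [hr]
      push_cast
      field_simp
      ring
  simp only [hlin, hpow] at hfg hg
  set K := C * ((N + (⌊P⌋₊ : ℝ) ^ (2 * (j + 1))) * (⌊P⌋₊ : ℝ) ^ j) with hK
  have hK0 : 0 ≤ K := by positivity
  have hconj : Real.HolderConjugate ((r + 1) / r) (r + 1) := by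
    rw [Real.holderConjugate_iff]
    refine ⟨by rw [lt_div_iff₀ hr0]; linarith, ?_⟩
    field_simp
  have hT1 : T ≤ F ^ (r / (r + 1)) * (K * T) ^ (1 / (r + 1)) := by
    calc T = ‖((T : ℝ) : ℂ)‖ := by rw [Complex.norm_real, Real.norm_of_nonneg hT0]
      _ = ‖∑ n ∈ Finset.Icc 1 N, f n * g n‖ := by rw [hfg]
      _ ≤ ∑ n ∈ Finset.Icc 1 N, ‖f n‖ * ‖g n‖ := by
        refine (norm_sum_le _ _).trans_eq (Finset.sum_congr rfl fun n _ => norm_mul _ _)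
      _ ≤ F ^ (1 / ((r + 1) / r)) * (∑ n ∈ Finset.Icc 1 N, ‖g n‖ ^ (r + 1)) ^ (1 / (r + 1)) :=
        Real.inner_le_Lp_mul_Lq_of_nonneg _ hconj (fun _ _ => norm_nonneg _)
          (fun _ _ => norm_nonneg _)
      _ ≤ _ := by
        rw [one_div_div]
        have h2 : ∀ n, ‖g n‖ ^ (r + 1) = ‖g n‖ ^ (2 * (j + 1)) := by
          intro n
          rw [← Real.rpow_natCast, hr]
          congr 1
          push_cast
          ring
        simp only [h2]
        refine mul_le_mul_of_nonneg_left (Real.rpow_le_rpow ?_ (hg.trans_eq ?_) ?_) ?_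
        · positivity
        · rw [hK]; ring
        · positivity
        · positivity
  refine (le_rpow_mul_of_le_rpow_mul_rpow hT0 hF0 hK0 hr0 hT1).trans ?_
  refine mul_le_mul_of_nonneg_right ?_ hF0
  have hfl : (⌊P⌋₊ : ℝ) ≤ P := Nat.floor_le hP0
  calc K ^ (1 / r) ≤ (C * ((N + P ^ (2 * (j + 1))) * P ^ j)) ^ (1 / r) := by
        rw [hK]
        gcongr
    _ = C ^ (1 / r) * (((N : ℝ) + P ^ (2 * (j + 1))) ^ (1 / r) * (P ^ j) ^ (1 / r)) := by
      rw [Real.mul_rpow hC (by positivity), Real.mul_rpow (by positivity) (by positivity)]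
    _ ≤ (C ^ (1 / r) + 1) * (((N : ℝ) ^ (1 / r) + (P ^ (2 * (j + 1))) ^ (1 / r)) *
        (P ^ j) ^ (1 / r)) := by
      have := Real.rpow_add_le_add_rpow (Nat.cast_nonneg N)
        (by positivity : 0 ≤ P ^ (2 * (j + 1))) (by positivity : 0 ≤ 1 / r)
        (by rw [div_le_one hr0]; exact hr1)
      gcongr
      linarith
    _ = _ := by
      have h1 : (P ^ j) ^ (1 / r) = P ^ ((j : ℝ) / r) := by
        rw [← Real.rpow_natCast_mul hP0, mul_one_div]
      have h2 : (P ^ (2 * (j + 1))) ^ (1 / r) = P ^ ((r + 1) / r) := by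
        rw [← Real.rpow_natCast_mul hP0, mul_one_div, hr]
        congr 2
        push_cast
        ring
      rw [h1, h2]
      ring
end

section
/- (Larger sieve with non-uniform sieving size.) Let α ∈ (0,1) and c > 0 be reals and set c' = c³α/100. There exist a constant C > 0 and an integer N₀ (depending on α and c) such that the following holds for all N ≥ N₀. Let A ⊆ [N] be a subset and let 𝒫 be a set of primes p ≤ N^α with Σ_{p∈𝒫} (log p / p) ≥ c · Σ_{p ≤ N^α} (log p / p). Suppose that Σ_{p ≤ N^α} (log p / p)·(|A mod p| / p) ≤ (α + c') · Σ_{p ≤ N^α} (log p / p) and Σ_{p∈𝒫} (log p / p)·(|A mod p| / p) ≤ (α − c) · Σ_{p∈𝒫} (log p / p). Then |A| ≤ C · N^{α−c'}. -/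
/-- `A` reduced modulo `p`. -/
def modImage (A : Finset ℕ) (p : ℕ) : Finset (ZMod p) :=
  A.image (fun a => (Nat.cast a : ZMod p))

open Finset in
/-- Exchanging sums in `log n! = ∑_{d ≤ n} Λ(d) ⌊n / d⌋`. -/
theorem sum_vonMangoldt_mul_div_eq_log_factorial (n : ℕ) :
    ∑ d ∈ Ioc 0 n, ArithmeticFunction.vonMangoldt d * ((n / d : ℕ) : ℝ) =
      Real.log (n.factorial : ℝ) := by
  rw [← ArithmeticFunction.sum_Ioc_mul_zeta_eq_sum, ArithmeticFunction.vonMangoldt_mul_zeta]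
  induction n with
  | zero => simp
  | succ k ih =>
    rw [← Finset.insert_Ioc_right_eq_Ioc_add_one (Nat.zero_le k), sum_insert (by simp), ih,
      Nat.factorial_succ, Nat.cast_mul, Real.log_mul (by positivity) (by positivity)]
    simp

open Finset in
theorem sum_vonMangoldt_div_le (n : ℕ) (hn : n ≠ 0) :
    ∑ d ∈ Ioc 0 n, ArithmeticFunction.vonMangoldt d / d ≤
      Real.log n + (Real.log 4 + 4) := by
  have hn' : (0 : ℝ) < n := by positivity
  have h1 : (n : ℝ) * ∑ d ∈ Ioc 0 n, ArithmeticFunction.vonMangoldt d / d ≤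
      Real.log (n.factorial : ℝ) + Chebyshev.psi n := by
    rw [← sum_vonMangoldt_mul_div_eq_log_factorial, Chebyshev.psi, Nat.floor_natCast, mul_sum,
      ← sum_add_distrib]
    refine sum_le_sum fun d hd => ?_
    have hd0 : 0 < d := (mem_Ioc.1 hd).1
    have hlt : (n : ℝ) / d ≤ ((n / d : ℕ) : ℝ) + 1 := by
      rw [← Nat.floor_div_eq_div (K := ℝ)]
      exact (Nat.lt_floor_add_one _).le
    have := mul_le_mul_of_nonneg_left hlt
      (ArithmeticFunction.vonMangoldt_nonneg (n := d))
    calc (n : ℝ) * (ArithmeticFunction.vonMangoldt d / d)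
        = ArithmeticFunction.vonMangoldt d * (n / d) := by ring
      _ ≤ _ := by linarith
  have h2 : Real.log (n.factorial : ℝ) ≤ n * Real.log n := by
    rw [← Real.log_pow]
    exact Real.log_le_log (by positivity) (by exact_mod_cast Nat.factorial_le_pow n)
  have h3 := Chebyshev.psi_le_const_mul_self hn'.le
  refine le_of_mul_le_mul_left ?_ hn'
  linarith

open Finset in
theorem le_sum_vonMangoldt_div (n : ℕ) (hn : n ≠ 0) :
    Real.log n - 1 ≤ ∑ d ∈ Ioc 0 n, ArithmeticFunction.vonMangoldt d / d := by
  have hn' : (0 : ℝ) < n := by positivity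
  have h1 : Real.log (n.factorial : ℝ) ≤
      (n : ℝ) * ∑ d ∈ Ioc 0 n, ArithmeticFunction.vonMangoldt d / d := by
    rw [← sum_vonMangoldt_mul_div_eq_log_factorial, mul_sum]
    refine sum_le_sum fun d _ => ?_
    calc ArithmeticFunction.vonMangoldt d * ((n / d : ℕ) : ℝ)
        ≤ ArithmeticFunction.vonMangoldt d * (n / d) :=
          mul_le_mul_of_nonneg_left Nat.cast_div_le ArithmeticFunction.vonMangoldt_nonneg
      _ = _ := by ring
  have h2 := Stirling.le_log_factorial_stirling hn
  have h3 : 0 ≤ Real.log n := Real.log_natCast_nonneg n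
  have h4 : 0 ≤ Real.log (2 * Real.pi) := Real.log_nonneg (by linarith [Real.pi_gt_three])
  refine le_of_mul_le_mul_left ?_ hn'
  linarith

/-- The contribution of the proper prime powers to `∑ Λ(n) / n` is finite. -/
theorem summable_vonMangoldt_not_prime_div :
    Summable fun n : ℕ => (if n.Prime then 0 else ArithmeticFunction.vonMangoldt n) / n := by
  have h := ArithmeticFunction.vonMangoldt.summable_residueClass_non_primes_div (q := 1) 0
  refine h.congr fun n => ?_
  have : ArithmeticFunction.vonMangoldt.residueClass (0 : ZMod 1) n =
      ArithmeticFunction.vonMangoldt n := by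
    simp [ArithmeticFunction.vonMangoldt.residueClass, Set.indicator,
      Subsingleton.elim _ (0 : ZMod 1)]
  rw [this]

theorem primesUpTo_eq_filter_Ioc (x : ℝ) :
    primesUpTo x = (Finset.Ioc 0 ⌊x⌋₊).filter Nat.Prime := by
  ext p
  simp only [primesUpTo, Finset.mem_filter, Finset.mem_range, Finset.mem_Ioc]
  constructor
  · rintro ⟨h, hp⟩
    exact ⟨⟨hp.pos, by omega⟩, hp⟩
  · rintro ⟨h, hp⟩
    exact ⟨by omega, hp⟩

/-- Mertens' first theorem. -/
theorem exists_abs_sum_log_div_sub_log_le :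
    ∃ M : ℝ, 0 ≤ M ∧ ∀ x : ℝ, 1 ≤ x →
      |∑ p ∈ primesUpTo x, Real.log p / p - Real.log x| ≤ M := by
  set B := ∑' n : ℕ, (if n.Prime then 0 else ArithmeticFunction.vonMangoldt n) / (n : ℝ)
  have hnn : ∀ n : ℕ,
      0 ≤ (if n.Prime then 0 else ArithmeticFunction.vonMangoldt n) / (n : ℝ) := fun n => by
    have := ArithmeticFunction.vonMangoldt_nonneg (n := n)
    split_ifs <;> positivity
  have hB0 : 0 ≤ B := tsum_nonneg hnn
  have hl4 : 0 ≤ Real.log 4 := Real.log_nonneg (by norm_num)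
  have hl2 : 0 ≤ Real.log 2 := Real.log_nonneg (by norm_num)
  refine ⟨B + 1 + Real.log 2 + (Real.log 4 + 4), by linarith, fun x hx => ?_⟩
  set n := ⌊x⌋₊ with hn
  have hn0 : n ≠ 0 := (Nat.floor_pos.2 hx).ne'
  have hnpos : (0 : ℝ) < n := by positivity
  have hn1 : (1 : ℝ) ≤ n := by exact_mod_cast Nat.one_le_iff_ne_zero.2 hn0
  have hnx : (n : ℝ) ≤ x := Nat.floor_le (by linarith)
  have hxn : x ≤ 2 * n := by linarith [Nat.lt_floor_add_one x]
  have hlog1 : Real.log n ≤ Real.log x := Real.log_le_log hnpos hnx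
  have hlog2 : Real.log x ≤ Real.log 2 + Real.log n := by
    rw [← Real.log_mul (by norm_num) hnpos.ne']
    exact Real.log_le_log (by linarith) hxn
  have hsplit : ∑ d ∈ Finset.Ioc 0 n, ArithmeticFunction.vonMangoldt d / (d : ℝ) =
      ∑ p ∈ primesUpTo x, Real.log p / p + ∑ d ∈ Finset.Ioc 0 n,
        (if d.Prime then 0 else ArithmeticFunction.vonMangoldt d) / (d : ℝ) := by
    rw [primesUpTo_eq_filter_Ioc, Finset.sum_filter, ← Finset.sum_add_distrib]
    refine Finset.sum_congr rfl fun d _ => ?_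
    split_ifs with h
    · simp [ArithmeticFunction.vonMangoldt_apply_prime h]
    · simp
  have hle := summable_vonMangoldt_not_prime_div.sum_le_tsum (Finset.Ioc 0 n) fun i _ => hnn i
  have hge := Finset.sum_nonneg fun i (_ : i ∈ Finset.Ioc 0 n) => hnn i
  have h1 := sum_vonMangoldt_div_le n hn0
  have h2 := le_sum_vonMangoldt_div n hn0
  rw [abs_le]
  constructor <;> linarith

theorem sum_primesUpTo_log_le {x : ℝ} (hx : 0 ≤ x) :
    ∑ p ∈ primesUpTo x, Real.log p ≤ Real.log 4 * x := by
  rw [primesUpTo_eq_filter_Ioc]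
  exact Chebyshev.theta_le_log4_mul_x hx

theorem sum_log_primes_dvd_le {T : Finset ℕ} (hT : ∀ p ∈ T, p.Prime) {D : ℕ} (hD : D ≠ 0) :
    ∑ p ∈ T with p ∣ D, Real.log p ≤ Real.log D := by
  rw [← ArithmeticFunction.vonMangoldt_sum]
  calc ∑ p ∈ T with p ∣ D, Real.log p
      = ∑ p ∈ T with p ∣ D, ArithmeticFunction.vonMangoldt p :=
        Finset.sum_congr rfl fun p hp =>
          (ArithmeticFunction.vonMangoldt_apply_prime (hT p (Finset.mem_filter.1 hp).1)).symm
    _ ≤ _ := by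
        refine Finset.sum_le_sum_of_subset_of_nonneg (fun p hp => ?_) fun _ _ _ =>
          ArithmeticFunction.vonMangoldt_nonneg
        exact Nat.mem_divisors.2 ⟨(Finset.mem_filter.1 hp).2, hD⟩

/-- Cauchy-Schwarz lower bound for the number of pairs with the same image. -/
theorem card_sq_le_card_image_mul_card_pairs {ι κ : Type*} [DecidableEq κ]
    (A : Finset ι) (f : ι → κ) :
    A.card ^ 2 ≤ (A.image f).card * ((A ×ˢ A).filter fun z => f z.1 = f z.2).card := by
  have hpairs : ((A ×ˢ A).filter fun z => f z.1 = f z.2).card =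
      ∑ y ∈ A.image f, (A.filter fun a => f a = y).card ^ 2 := by
    rw [Finset.card_eq_sum_card_fiberwise (f := fun z => f z.1) (t := A.image f)]
    · refine Finset.sum_congr rfl fun y _ => ?_
      rw [sq, ← Finset.card_product]
      congr 1
      ext ⟨a, b⟩
      simp only [Finset.mem_filter, Finset.mem_product]
      grind
    · intro z hz
      simp only [Finset.coe_filter, Finset.mem_product, Set.mem_ofPred_eq] at hz
      exact Finset.mem_coe.2 (Finset.mem_image_of_mem f hz.1.1)
  rw [hpairs, Finset.card_eq_sum_card_image f A]
  exact sq_sum_le_card_mul_sum_sq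

theorem sum_log_congr_le {N : ℕ} {A : Finset ℕ} (hA : A ⊆ Finset.Icc 1 N) {T : Finset ℕ}
    (hT : ∀ p ∈ T, p.Prime) {a b : ℕ} (ha : a ∈ A) (hb : b ∈ A) (hab : a ≠ b) :
    ∑ p ∈ T with ((a : ZMod p) = (b : ZMod p)), Real.log p ≤ Real.log N := by
  have ha' := Finset.mem_Icc.1 (hA ha)
  have hb' := Finset.mem_Icc.1 (hA hb)
  have hD : ((b : ℤ) - a).natAbs ≠ 0 := by omega
  have hDN : ((b : ℤ) - a).natAbs ≤ N := by omega
  calc ∑ p ∈ T with ((a : ZMod p) = (b : ZMod p)), Real.log p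
      = ∑ p ∈ T with p ∣ ((b : ℤ) - a).natAbs, Real.log p := by
        congr 1
        refine Finset.filter_congr fun p _ => ?_
        rw [ZMod.natCast_eq_natCast_iff, Nat.modEq_iff_dvd, Int.natCast_dvd]
    _ ≤ Real.log (((b : ℤ) - a).natAbs : ℕ) := sum_log_primes_dvd_le hT hD
    _ ≤ Real.log N := Real.log_le_log (by positivity) (by exact_mod_cast hDN)

/-- Gallagher's larger sieve. -/
theorem larger_sieve {N : ℕ} {A : Finset ℕ} (hA : A ⊆ Finset.Icc 1 N) (hne : A.Nonempty)
    {T : Finset ℕ} (hT : ∀ p ∈ T, p.Prime) :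
    (A.card : ℝ) * (∑ p ∈ T, Real.log p / ((modImage A p).card : ℝ)) ≤
      A.card * Real.log N + ∑ p ∈ T, Real.log p := by
  classical
  have hcard : (0 : ℝ) < A.card := by exact_mod_cast hne.card_pos
  have hlow : (A.card : ℝ) ^ 2 * (∑ p ∈ T, Real.log p / ((modImage A p).card : ℝ)) ≤
      ∑ p ∈ T, Real.log p *
        (((A ×ˢ A).filter fun z => (z.1 : ZMod p) = (z.2 : ZMod p)).card : ℝ) := by
    rw [Finset.mul_sum]
    refine Finset.sum_le_sum fun p _ => ?_
    have hpos : (0 : ℝ) < (modImage A p).card := by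
      exact_mod_cast (hne.image _).card_pos
    have hcs : (A.card : ℝ) ^ 2 ≤ ((modImage A p).card : ℝ) *
        (((A ×ˢ A).filter fun z => (z.1 : ZMod p) = (z.2 : ZMod p)).card : ℝ) := by
      exact_mod_cast card_sq_le_card_image_mul_card_pairs A (fun a : ℕ => (a : ZMod p))
    rw [← mul_div_assoc, div_le_iff₀ hpos]
    have := mul_le_mul_of_nonneg_left hcs (Real.log_natCast_nonneg p)
    linarith
  have hswap : ∑ p ∈ T, Real.log p *
        (((A ×ˢ A).filter fun z => (z.1 : ZMod p) = (z.2 : ZMod p)).card : ℝ) =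
      ∑ z ∈ A ×ˢ A, ∑ p ∈ T with ((z.1 : ZMod p) = (z.2 : ZMod p)), Real.log p := by
    simp only [Finset.sum_filter]
    rw [Finset.sum_comm]
    refine Finset.sum_congr rfl fun p _ => ?_
    rw [← Finset.sum_filter, Finset.sum_const, nsmul_eq_mul, mul_comm]
  have hup : ∑ z ∈ A ×ˢ A, ∑ p ∈ T with ((z.1 : ZMod p) = (z.2 : ZMod p)), Real.log p ≤
      (A.card : ℝ) ^ 2 * Real.log N + A.card * ∑ p ∈ T, Real.log p := by
    calc ∑ z ∈ A ×ˢ A, ∑ p ∈ T with ((z.1 : ZMod p) = (z.2 : ZMod p)), Real.log p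
        ≤ ∑ z ∈ A ×ˢ A, (Real.log N + if z.1 = z.2 then ∑ p ∈ T, Real.log p else 0) := by
          refine Finset.sum_le_sum fun z hz => ?_
          have hz' := Finset.mem_product.1 hz
          split_ifs with h
          · simp only [h, Finset.filter_true]
            linarith [Real.log_natCast_nonneg N]
          · rw [add_zero]
            exact sum_log_congr_le hA hT hz'.1 hz'.2 h
      _ = _ := by
          rw [Finset.sum_add_distrib, Finset.sum_product (s := A) (t := A)
            (f := fun z => if z.1 = z.2 then ∑ p ∈ T, Real.log p else 0)]
          simp [sq]
  refine le_of_mul_le_mul_left ?_ hcard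
  linarith

theorem two_div_sub_div_sq_le_inv {x t : ℝ} (hx : 0 < x) (ht : 0 < t) :
    2 / t - x / t ^ 2 ≤ 1 / x := by
  have h : 1 / x - (2 / t - x / t ^ 2) = (x - t) ^ 2 / (x * t ^ 2) := by
    field_simp
    ring
  have : 0 ≤ (x - t) ^ 2 / (x * t ^ 2) := by positivity
  linarith

/-- A lower bound for `∑ w / x` over `R ⊆ S`, by comparing `1 / x` with its tangent lines at
`t` on `P` and at `s` elsewhere. -/
theorem tangent_le_sum_div {ι : Type*} {S R P : Finset ι} (hR : R ⊆ S) (hP : P ⊆ S)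
    {w x : ι → ℝ} (hw : ∀ i ∈ S, 0 ≤ w i) (hx : ∀ i ∈ S, 0 < x i) {s t : ℝ} (ht : 0 < t)
    (hts : t ≤ s) :
    2 / s * ∑ i ∈ S, w i - (∑ i ∈ S, w i * x i) / s ^ 2 + (2 / t - 2 / s) * ∑ i ∈ P, w i
      - (1 / t ^ 2 - 1 / s ^ 2) * (∑ i ∈ P, w i * x i)
      - 2 / t * (∑ i ∈ S, w i - ∑ i ∈ R, w i) ≤ ∑ i ∈ R, w i / x i := by
  classical
  have hs : 0 < s := ht.trans_le hts
  set g : ι → ℝ := fun i => if i ∈ P then w i * (2 / t - x i / t ^ 2)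
    else w i * (2 / s - x i / s ^ 2) with hg
  have hgS : ∑ i ∈ S, g i = 2 / s * ∑ i ∈ S, w i - (∑ i ∈ S, w i * x i) / s ^ 2
      + (2 / t - 2 / s) * ∑ i ∈ P, w i
      - (1 / t ^ 2 - 1 / s ^ 2) * (∑ i ∈ P, w i * x i) := by
    have h1 : ∑ i ∈ P, ((2 / t - 2 / s) * w i - (1 / t ^ 2 - 1 / s ^ 2) * (w i * x i)) =
        ∑ i ∈ S, if i ∈ P then
          ((2 / t - 2 / s) * w i - (1 / t ^ 2 - 1 / s ^ 2) * (w i * x i)) else 0 := by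
      rw [Finset.sum_ite_mem, Finset.inter_eq_right.2 hP]
    have h2 : ∑ i ∈ S, g i = ∑ i ∈ S, (2 / s * w i - (w i * x i) / s ^ 2) +
        ∑ i ∈ P, ((2 / t - 2 / s) * w i - (1 / t ^ 2 - 1 / s ^ 2) * (w i * x i)) := by
      rw [h1, ← Finset.sum_add_distrib]
      refine Finset.sum_congr rfl fun i _ => ?_
      simp only [hg]
      split_ifs <;> ring
    rw [h2, Finset.sum_sub_distrib, Finset.sum_sub_distrib, Finset.mul_sum, Finset.mul_sum,
      Finset.mul_sum, Finset.sum_div]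
    ring
  have hgR : ∑ i ∈ R, g i ≤ ∑ i ∈ R, w i / x i := by
    refine Finset.sum_le_sum fun i hi => ?_
    have hwi := hw i (hR hi)
    have hxi := hx i (hR hi)
    rw [div_eq_mul_one_div]
    simp only [hg]
    split_ifs
    · exact mul_le_mul_of_nonneg_left (two_div_sub_div_sq_le_inv hxi ht) hwi
    · exact mul_le_mul_of_nonneg_left (two_div_sub_div_sq_le_inv hxi hs) hwi
  have htail : ∑ i ∈ S \ R, g i ≤ 2 / t * ∑ i ∈ S \ R, w i := by
    rw [Finset.mul_sum]
    refine Finset.sum_le_sum fun i hi => ?_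
    have hi' := (Finset.mem_sdiff.1 hi).1
    have hwi := hw i hi'
    have hxi := hx i hi'
    rw [mul_comm (2 / t)]
    simp only [hg]
    split_ifs
    · refine mul_le_mul_of_nonneg_left ?_ hwi
      have : 0 ≤ x i / t ^ 2 := by positivity
      linarith
    · refine mul_le_mul_of_nonneg_left ?_ hwi
      have : 0 ≤ x i / s ^ 2 := by positivity
      have : 2 / s ≤ 2 / t := by gcongr
      linarith
  have e1 := Finset.sum_sdiff (f := g) hR
  have e2 := Finset.sum_sdiff (f := w) hR
  have e3 : ∑ i ∈ S, w i - ∑ i ∈ R, w i = ∑ i ∈ S \ R, w i := by linarith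
  rw [e3, ← hgS]
  linarith

/-- The increment over the uniform bound `W / α` that a dense set of indices of mean at most
`α - c` brings. -/
theorem tangent_main_term_ge {α c κ W X V Y : ℝ} (hα0 : 0 < α) (hc : 0 < c) (hcα : c < α)
    (hV : c * W ≤ V) (hX : X ≤ (α + κ) * W) (hY : Y ≤ (α - c) * V) :
    (1 / α + c ^ 3 / (α ^ 2 * (α - c)) - κ / α ^ 2) * W ≤
      2 / α * W - X / α ^ 2 + (2 / (α - c) - 2 / α) * V
        - (1 / (α - c) ^ 2 - 1 / α ^ 2) * Y := by
  have ht : 0 < α - c := by linarith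
  have h1 : X / α ^ 2 ≤ (α + κ) * W / α ^ 2 := by gcongr
  have h2 : (1 / (α - c) ^ 2 - 1 / α ^ 2) * Y ≤
      (1 / (α - c) ^ 2 - 1 / α ^ 2) * ((α - c) * V) := by
    refine mul_le_mul_of_nonneg_left hY (sub_nonneg.2 ?_)
    gcongr
    linarith
  have h3 : c ^ 2 / (α ^ 2 * (α - c)) * (c * W) ≤ c ^ 2 / (α ^ 2 * (α - c)) * V :=
    mul_le_mul_of_nonneg_left hV (by positivity)
  have h4 : 2 / α * W - (α + κ) * W / α ^ 2 + (2 / (α - c) - 2 / α) * V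
        - (1 / (α - c) ^ 2 - 1 / α ^ 2) * ((α - c) * V) =
      (1 / α - κ / α ^ 2) * W + c ^ 2 / (α ^ 2 * (α - c)) * V := by
    field_simp
    ring
  have h5 : (1 / α + c ^ 3 / (α ^ 2 * (α - c)) - κ / α ^ 2) * W =
      (1 / α - κ / α ^ 2) * W + c ^ 2 / (α ^ 2 * (α - c)) * (c * W) := by
    field_simp
    ring
  linarith

theorem log_add_one_le_main_term {α c M L W τ : ℝ} (hα0 : 0 < α) (hα1 : α < 1) (hc : 0 < c)
    (hcα : c < α) (hM : 0 ≤ M) (hL0 : 0 ≤ L)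
    (hL : M * (1 / α + c ^ 3 / (α ^ 2 * (α - c)) + 4 / (α - c)) + 1 ≤ c ^ 3 / 2 * L)
    (hW : α * L - M ≤ W) (hτ : τ ≤ c ^ 3 * α / 100 * L + 2 * M) :
    L + 1 ≤ (1 / α + c ^ 3 / (α ^ 2 * (α - c)) - c ^ 3 * α / 100 / α ^ 2) * W
      - 2 / (α - c) * τ := by
  have ht : 0 < α - c := by linarith
  have hk : 0 ≤ 1 / α + c ^ 3 / (α ^ 2 * (α - c)) - c ^ 3 * α / 100 / α ^ 2 := by
    have : c ^ 3 * α / 100 / α ^ 2 ≤ 1 / α := by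
      rw [div_div, div_le_div_iff₀ (by positivity) hα0]
      have : c ^ 3 ≤ 1 := pow_le_one₀ hc.le (by linarith)
      nlinarith [sq_nonneg α]
    have : 0 ≤ c ^ 3 / (α ^ 2 * (α - c)) := by positivity
    linarith
  have h1 := mul_le_mul_of_nonneg_left hW hk
  have h2 : 2 / (α - c) * τ ≤ 2 / (α - c) * (c ^ 3 * α / 100 * L + 2 * M) :=
    mul_le_mul_of_nonneg_left hτ (by positivity)
  have hgain : c ^ 3 / 2 ≤
      c ^ 3 / (α * (α - c)) - c ^ 3 / 100 - 2 * c ^ 3 * α / (100 * (α - c)) := by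
    have : c ^ 3 / (α * (α - c)) - c ^ 3 / 100 - 2 * c ^ 3 * α / (100 * (α - c)) - c ^ 3 / 2 =
        c ^ 3 * (100 - 51 * α * (α - c) - 2 * α ^ 2) / (100 * (α * (α - c))) := by
      field_simp
      ring
    have h : 0 ≤ c ^ 3 * (100 - 51 * α * (α - c) - 2 * α ^ 2) / (100 * (α * (α - c))) := by
      have : 0 ≤ 100 - 51 * α * (α - c) - 2 * α ^ 2 := by nlinarith
      positivity
    linarith
  have h3 := mul_le_mul_of_nonneg_right hgain hL0
  have h4 : (1 / α + c ^ 3 / (α ^ 2 * (α - c)) - c ^ 3 * α / 100 / α ^ 2) * (α * L - M)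
      - 2 / (α - c) * (c ^ 3 * α / 100 * L + 2 * M) =
      L + (c ^ 3 / (α * (α - c)) - c ^ 3 / 100 - 2 * c ^ 3 * α / (100 * (α - c))) * L
      - M * (1 / α + c ^ 3 / (α ^ 2 * (α - c)) + 4 / (α - c))
      + M * (c ^ 3 * α / 100 / α ^ 2) := by
    field_simp
    ring
  have h5 : 0 ≤ M * (c ^ 3 * α / 100 / α ^ 2) := by positivity
  linarith

theorem larger_sieve_nonuniform_size (α : ℝ) (hα0 : 0 < α) (hα1 : α < 1)
    (c : ℝ) (hc : 0 < c) :
    ∃ C : ℝ, C > 0 ∧ ∃ N₀ : ℕ, ∀ N : ℕ, N ≥ N₀ →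
      ∀ A : Finset ℕ, A ⊆ Finset.Icc 1 N →
        ∀ Ps : Finset ℕ, (∀ p ∈ Ps, p.Prime ∧ (p : ℝ) ≤ (N : ℝ) ^ α) →
          (∑ p ∈ Ps, Real.log p / p) ≥
            c * ∑ p ∈ primesUpTo ((N : ℝ) ^ α), Real.log p / p →
          (∑ p ∈ primesUpTo ((N : ℝ) ^ α),
              (Real.log p / p) * (((modImage A p).card : ℝ) / p)) ≤
            (α + c ^ 3 * α / 100) * ∑ p ∈ primesUpTo ((N : ℝ) ^ α), Real.log p / p →
          (∑ p ∈ Ps, (Real.log p / p) * (((modImage A p).card : ℝ) / p)) ≤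
            (α - c) * ∑ p ∈ Ps, Real.log p / p →
          (A.card : ℝ) ≤ C * (N : ℝ) ^ (α - c ^ 3 * α / 100) := by
  obtain ⟨M, hM0, hM⟩ := exists_abs_sum_log_div_sub_log_le
  have htend : Filter.Tendsto (fun N : ℕ => Real.log (N : ℝ)) Filter.atTop Filter.atTop :=
    Real.tendsto_log_atTop.comp tendsto_natCast_atTop_atTop
  set K := M * (1 / α + c ^ 3 / (α ^ 2 * (α - c)) + 4 / (α - c)) + 1
  obtain ⟨N₀, hN₀⟩ := Filter.eventually_atTop.1
    ((htend.eventually_ge_atTop (K / (c ^ 3 / 2))).and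
      ((htend.eventually_ge_atTop ((M + 1) / α)).and (Filter.eventually_ge_atTop 1)))
  refine ⟨Real.log 4, Real.log_pos (by norm_num), N₀, fun N hN A hA Ps hPs hV hX hY => ?_⟩
  obtain ⟨hL1, hL2, hN1⟩ := hN₀ N hN
  have hNpos : (0 : ℝ) < N := by exact_mod_cast hN1
  have hN1' : (1 : ℝ) ≤ N := by exact_mod_cast hN1
  rcases A.eq_empty_or_nonempty with rfl | hne
  · simp only [Finset.card_empty, Nat.cast_zero]
    positivity
  have hL0 : 0 ≤ Real.log N := Real.log_natCast_nonneg N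
  have hprime : ∀ (y : ℝ), ∀ p ∈ primesUpTo y, p.Prime := fun y p hp => (Finset.mem_filter.1 hp).2
  have hPsub : Ps ⊆ primesUpTo ((N : ℝ) ^ α) := fun p hp =>
    Finset.mem_filter.2 ⟨Finset.mem_range_succ_iff.2 (Nat.le_floor (hPs p hp).2), (hPs p hp).1⟩
  have hw : ∀ p : ℕ, 0 ≤ Real.log p / p := fun p =>
    div_nonneg (Real.log_natCast_nonneg p) p.cast_nonneg
  have hcardpos : ∀ p : ℕ, (0 : ℝ) < (modImage A p).card := fun p => by
    exact_mod_cast (hne.image _).card_pos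
  have hx : ∀ p : ℕ, p.Prime → 0 < ((modImage A p).card : ℝ) / p := fun p hp =>
    div_pos (hcardpos p) (by exact_mod_cast hp.pos)
  have hS := abs_le.1 (hM ((N : ℝ) ^ α) (Real.one_le_rpow hN1' hα0.le))
  rw [Real.log_rpow hNpos] at hS
  have hW : α * Real.log N - M ≤ ∑ p ∈ primesUpTo ((N : ℝ) ^ α), Real.log p / p := by
    linarith [hS.1]
  have hcα : c < α := by
    by_contra! hcon
    have h1 : M + 1 ≤ α * Real.log N := by
      rw [div_le_iff₀ hα0] at hL2
      linarith
    have hVpos : 0 < ∑ p ∈ Ps, Real.log p / p :=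
      lt_of_lt_of_le (mul_pos hc (by linarith)) hV
    have hPne : Ps.Nonempty := by
      by_contra h
      simp [Finset.not_nonempty_iff_eq_empty.1 h] at hVpos
    have hYpos : 0 < ∑ p ∈ Ps, (Real.log p / p) * (((modImage A p).card : ℝ) / p) :=
      Finset.sum_pos (fun p hp => mul_pos
        (div_pos (Real.log_pos (by exact_mod_cast (hPs p hp).1.one_lt))
          (by exact_mod_cast (hPs p hp).1.pos)) (hx p (hPs p hp).1)) hPne
    have := mul_nonneg (sub_nonneg.2 hcon) hVpos.le
    linarith
  have hc3 : c ^ 3 ≤ 1 := pow_le_one₀ hc.le (by linarith)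
  have hexp : 0 ≤ α - c ^ 3 * α / 100 := by nlinarith
  have hS' := abs_le.1 (hM ((N : ℝ) ^ (α - c ^ 3 * α / 100)) (Real.one_le_rpow hN1' hexp))
  rw [Real.log_rpow hNpos] at hS'
  have hRsub : primesUpTo ((N : ℝ) ^ (α - c ^ 3 * α / 100)) ⊆ primesUpTo ((N : ℝ) ^ α) := by
    have hle : (N : ℝ) ^ (α - c ^ 3 * α / 100) ≤ (N : ℝ) ^ α :=
      Real.rpow_le_rpow_of_exponent_le hN1' (by linarith [show 0 ≤ c ^ 3 * α / 100 by positivity])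
    exact Finset.filter_subset_filter _
      (Finset.range_mono (Nat.succ_le_succ (Nat.floor_le_floor hle)))
  have hKL : K ≤ c ^ 3 / 2 * Real.log N := by
    rw [div_le_iff₀ (by positivity)] at hL1
    linarith
  have hmain := log_add_one_le_main_term hα0 hα1 hc hcα hM0 hL0 hKL hW
    (τ := ∑ p ∈ primesUpTo ((N : ℝ) ^ α), Real.log p / p -
      ∑ p ∈ primesUpTo ((N : ℝ) ^ (α - c ^ 3 * α / 100)), Real.log p / p)
    (by linarith [hS.2, hS'.1])
  have htan := tangent_main_term_ge hα0 hc hcα hV hX hY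
  have hsum := tangent_le_sum_div hRsub hPsub (w := fun p : ℕ => Real.log p / p)
    (x := fun p : ℕ => ((modImage A p).card : ℝ) / p) (fun p _ => hw p)
    (fun p hp => hx p (hprime _ p hp)) (s := α) (t := α - c) (by linarith) (by linarith)
  have heq : ∑ p ∈ primesUpTo ((N : ℝ) ^ (α - c ^ 3 * α / 100)),
        Real.log p / p / (((modImage A p).card : ℝ) / p) =
      ∑ p ∈ primesUpTo ((N : ℝ) ^ (α - c ^ 3 * α / 100)),
        Real.log p / ((modImage A p).card : ℝ) := by
    refine Finset.sum_congr rfl fun p hp => ?_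
    have : (p : ℝ) ≠ 0 := by exact_mod_cast (hprime _ p hp).ne_zero
    exact div_div_div_cancel_right₀ this _ _
  have hsieve := larger_sieve hA hne (hprime ((N : ℝ) ^ (α - c ^ 3 * α / 100)))
  have htheta := sum_primesUpTo_log_le
    (x := (N : ℝ) ^ (α - c ^ 3 * α / 100)) (by positivity)
  have hlower : Real.log N + 1 ≤ ∑ p ∈ primesUpTo ((N : ℝ) ^ (α - c ^ 3 * α / 100)),
      Real.log p / ((modImage A p).card : ℝ) := by
    rw [← heq]
    linarith
  have := mul_le_mul_of_nonneg_left hlower (Nat.cast_nonneg (α := ℝ) A.card)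
  linarith
end
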